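/- The differential on the strands algebra A(n) squares to zero: ∂∘∂ = 0. Together with associativity and the Leibniz rule, this makes (A(n), ∂) a differential algebra over 𝔽₂. -/

import Mathlib

/-- A strands diagram on `n` points `(S, T, φ)`, encoded by the graph of the
bijection `φ : S → T`: a finite set `g` of pairs `(i, φ i)`, such that each
strand has non-negative slope (`i ≤ φ i`) and the first (resp. second)
coordinates of distinct elements are distinct.  Here `S` (resp. `T`) is the set
of first (resp. second) coordinates of elements of `g`. -/
structure StrandsDiagram (n : ℕ) where
  g : Finset (Fin n × Fin n)
  slope : ∀ p ∈ g, p.1 ≤ p.2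
  inj : ∀ p ∈ g, ∀ q ∈ g, (p.1 = q.1 ↔ p.2 = q.2)

namespace StrandsDiagram

theorem ext' {n : ℕ} {a b : StrandsDiagram n} (h : a.g = b.g) : a = b := by
  cases a; cases b; cases h; rfl

instance (n : ℕ) : DecidableEq (StrandsDiagram n) := fun a b =>
  if h : a.g = b.g then .isTrue (ext' h) else .isFalse fun he => h (by cases he; rfl)

noncomputable instance (n : ℕ) : Fintype (StrandsDiagram n) :=
  Fintype.ofInjective StrandsDiagram.g fun _ _ h => ext' h

/-- The set `S` of initial points of the strands. -/
def dom {n : ℕ} (a : StrandsDiagram n) : Finset (Fin n) := a.g.image Prod.fst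

/-- The set `T` of terminal points of the strands. -/
def cod {n : ℕ} (a : StrandsDiagram n) : Finset (Fin n) := a.g.image Prod.snd

/-- The graph of the composition `ψ ∘ φ` of two partial bijections. -/
def compGraph {n : ℕ} (f h : Finset (Fin n × Fin n)) : Finset (Fin n × Fin n) :=
  ((f ×ˢ h).filter fun pq => pq.1.2 = pq.2.1).image fun pq => (pq.1.1, pq.2.2)

/-- The number of inversions (crossings) of a strands diagram with graph `f`. -/
def invCount {n : ℕ} (f : Finset (Fin n × Fin n)) : ℕ :=
  ((f ×ˢ f).filter fun pq => pq.1.1 < pq.2.1 ∧ pq.2.2 < pq.1.2).card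

/-- The underlying `𝔽₂`-vector space of the strands algebra `A(n)`, realized as
the space of `𝔽₂`-valued functions on the set of strands diagrams. -/
abbrev StrandsAlg (n : ℕ) := StrandsDiagram n → ZMod 2

/-- The basis vector of `A(n)` corresponding to a strands diagram. -/
def sd {n : ℕ} (a : StrandsDiagram n) : StrandsAlg n := fun b => if b = a then 1 else 0

/-- The multiplication of the strands algebra `A(n)`: the product of basis
elements `(S, T, φ)·(T′, U, ψ)` is zero if `T ≠ T′`; if `T = T′` it is
`(S, U, ψ ∘ φ)` when `inv(ψ ∘ φ) = inv(φ) + inv(ψ)`, and zero otherwise. -/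
noncomputable def smul' {n : ℕ} (x y : StrandsAlg n) : StrandsAlg n := fun c =>
  ∑ a : StrandsDiagram n, ∑ b : StrandsDiagram n,
    if cod a = dom b ∧ c.g = compGraph a.g b.g ∧
        invCount c.g = invCount a.g + invCount b.g then
      x a * y b
    else 0

/-- The element `u = ∑_S (S, S, id_S)` of `A(n)`: the indicator function of the
strands diagrams all of whose strands are horizontal. -/
def sunit (n : ℕ) : StrandsAlg n := fun a => if ∀ p ∈ a.g, p.1 = p.2 then 1 else 0

/-- The graph obtained by resolving the crossing of the two strands `p` and `q`
(interchanging their terminal points). -/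
def resGraph {n : ℕ} (f : Finset (Fin n × Fin n)) (p q : Fin n × Fin n) :
    Finset (Fin n × Fin n) :=
  insert (p.1, q.2) (insert (q.1, p.2) ((f.erase p).erase q))

/-- The coefficient of the strands diagram `c` in the differential of the strands
diagram `d`: the number (mod 2) of inversions (crossings) of `d` whose resolution
is `c` and decreases the number of inversions by exactly one (i.e. introduces no
double crossing). -/
noncomputable def delCoeff {n : ℕ} (d c : StrandsDiagram n) : ZMod 2 :=
  (((d.g ×ˢ d.g).filter fun pq =>
      pq.1.1 < pq.2.1 ∧ pq.2.2 < pq.1.2 ∧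
      resGraph d.g pq.1 pq.2 = c.g ∧
      invCount (resGraph d.g pq.1 pq.2) + 1 = invCount d.g).card : ZMod 2)

/-- The differential of the strands algebra `A(n)`: on a basis element it is the
sum of all resolutions of single crossings which decrease the number of
crossings by exactly one, extended `𝔽₂`-linearly. -/
noncomputable def sdel {n : ℕ} (x : StrandsAlg n) : StrandsAlg n := fun c =>
  ∑ d : StrandsDiagram n, delCoeff d c * x d

end StrandsDiagram

namespace StrandsDiagram

open Equiv

/-- Injectivity of a graph. -/
def GInj {n : ℕ} (f : Finset (Fin n × Fin n)) : Prop :=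
  ∀ p ∈ f, ∀ q ∈ f, (p.1 = q.1 ↔ p.2 = q.2)

/-- The value at `x` is larger than the value at `y`. -/
def R {n : ℕ} (f : Finset (Fin n × Fin n)) (x y : Fin n) : Prop :=
  ∃ u v, (x, u) ∈ f ∧ (y, v) ∈ f ∧ v < u

/-- Permuting the sources of a graph by a transposition. -/
def act {n : ℕ} (i j : Fin n) (f : Finset (Fin n × Fin n)) : Finset (Fin n × Fin n) :=
  f.image fun p => (swap i j p.1, p.2)

theorem mem_act {n : ℕ} (i j : Fin n) (f : Finset (Fin n × Fin n)) (x u : Fin n) :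
    (x, u) ∈ act i j f ↔ (swap i j x, u) ∈ f := by
  simp only [act, Finset.mem_image, Prod.exists, Prod.mk.injEq]
  constructor
  · rintro ⟨a, b, h, rfl, rfl⟩
    simpa using h
  · intro h
    exact ⟨_, _, h, by simp, rfl⟩

theorem R_act {n : ℕ} (i j : Fin n) (f : Finset (Fin n × Fin n)) (x y : Fin n) :
    R (act i j f) x y ↔ R f (swap i j x) (swap i j y) := by
  simp only [R, mem_act]

theorem GInj_act {n : ℕ} (i j : Fin n) {f : Finset (Fin n × Fin n)} (h : GInj f) :
    GInj (act i j f) := by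
  rintro ⟨a, b⟩ hp ⟨c, d⟩ hq
  rw [mem_act] at hp hq
  have := h _ hp _ hq
  simpa using this

theorem GInj.right {n : ℕ} {f : Finset (Fin n × Fin n)} (h : GInj f) {x u v : Fin n}
    (h1 : (x, u) ∈ f) (h2 : (x, v) ∈ f) : u = v := (h _ h1 _ h2).1 rfl

theorem GInj.left {n : ℕ} {f : Finset (Fin n × Fin n)} (h : GInj f) {x y u : Fin n}
    (h1 : (x, u) ∈ f) (h2 : (y, u) ∈ f) : x = y := (h _ h1 _ h2).2 rfl

theorem R_trans {n : ℕ} {f : Finset (Fin n × Fin n)} (h : GInj f) {x y z : Fin n}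
    (h1 : R f x y) (h2 : R f y z) : R f x z := by
  obtain ⟨u, v, a, b, c⟩ := h1
  obtain ⟨u', v', a', b', c'⟩ := h2
  have := h.right b a'
  subst this
  exact ⟨u, v', a, b', c'.trans c⟩

theorem R_asymm {n : ℕ} {f : Finset (Fin n × Fin n)} (h : GInj f) {x y : Fin n}
    (h1 : R f x y) (h2 : R f y x) : False := by
  obtain ⟨u, v, a, b, c⟩ := R_trans h h1 h2
  have := h.right a b
  omega

theorem R_total {n : ℕ} {f : Finset (Fin n × Fin n)} (h : GInj f) {x y z w : Fin n}
    (h1 : R f x y ∨ R f y x) (h2 : R f z w ∨ R f w z) (hne : x ≠ z) : R f x z ∨ R f z x := by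
  have e1 : ∃ u, (x, u) ∈ f := by
    rcases h1 with ⟨u, v, a, b, c⟩ | ⟨u, v, a, b, c⟩
    exacts [⟨_, a⟩, ⟨_, b⟩]
  have e2 : ∃ u, (z, u) ∈ f := by
    rcases h2 with ⟨u, v, a, b, c⟩ | ⟨u, v, a, b, c⟩
    exacts [⟨_, a⟩, ⟨_, b⟩]
  obtain ⟨u, hu⟩ := e1
  obtain ⟨v, hv⟩ := e2
  rcases lt_trichotomy u v with hh | hh | hh
  · exact Or.inr ⟨_, _, hv, hu, hh⟩
  · subst hh
    exact absurd (h.left hu hv) hne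
  · exact Or.inl ⟨_, _, hu, hv, hh⟩

open Classical in
/-- The inversions of a graph, as pairs of sources. -/
noncomputable def Inv {n : ℕ} (f : Finset (Fin n × Fin n)) : Finset (Fin n × Fin n) :=
  Finset.univ.filter fun x => x.1 < x.2 ∧ R f x.1 x.2

theorem mem_Inv {n : ℕ} {f : Finset (Fin n × Fin n)} {x : Fin n × Fin n} :
    x ∈ Inv f ↔ x.1 < x.2 ∧ R f x.1 x.2 := by
  simp [Inv]

theorem resGraph_eq {n : ℕ} {f : Finset (Fin n × Fin n)} (h : GInj f) {p q : Fin n × Fin n}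
    (hp : p ∈ f) (hq : q ∈ f) (hne : p.1 ≠ q.1) :
    resGraph f p q = act p.1 q.1 f := by
  obtain ⟨i, u⟩ := p
  obtain ⟨j, v⟩ := q
  ext ⟨x, w⟩
  rw [mem_act]
  simp only [resGraph, Finset.mem_insert, Finset.mem_erase, Prod.mk.injEq, ne_eq]
  have hu : ∀ w, (i, w) ∈ f ↔ w = u := fun w => ⟨fun h' => h.right h' hp, fun h' => h' ▸ hp⟩
  have hv : ∀ w, (j, w) ∈ f ↔ w = v := fun w => ⟨fun h' => h.right h' hq, fun h' => h' ▸ hq⟩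
  simp only at hne
  by_cases h1 : x = i
  · subst h1
    rw [swap_apply_left, hv]
    simp [hne, hu]
  · by_cases h2 : x = j
    · subst h2
      rw [swap_apply_right, hu]
      simp [Ne.symm hne, hv]
    · rw [swap_apply_of_ne_of_ne h1 h2]
      simp [h1, h2]

/-- Bijection between crossings as pairs of strands and as pairs of sources. -/
theorem card_cross {n : ℕ} {f : Finset (Fin n × Fin n)} (h : GInj f)
    (P : (Fin n × Fin n) → (Fin n × Fin n) → Prop) (Q : Fin n × Fin n → Prop)
    [DecidablePred Q] [∀ a b, Decidable (P a b)]
    (hPQ : ∀ p ∈ f, ∀ q ∈ f, p.1 < q.1 → (P p q ↔ Q (p.1, q.1))) :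
    ((f ×ˢ f).filter fun pq => pq.1.1 < pq.2.1 ∧ pq.2.2 < pq.1.2 ∧ P pq.1 pq.2).card =
      ((Inv f).filter Q).card := by
  apply Finset.card_bij (fun pq _ => (pq.1.1, pq.2.1))
  · rintro ⟨p, q⟩ hpq
    simp only [Finset.mem_filter, Finset.mem_product] at hpq
    obtain ⟨⟨hp, hq⟩, h1, h2, h3⟩ := hpq
    rw [Finset.mem_filter, mem_Inv]
    exact ⟨⟨h1, _, _, hp, hq, h2⟩, (hPQ p hp q hq h1).1 h3⟩
  · rintro ⟨p, q⟩ hpq ⟨p', q'⟩ hpq' he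
    simp only [Finset.mem_filter, Finset.mem_product] at hpq hpq'
    simp only [Prod.mk.injEq] at he ⊢
    have e1 := (h _ hpq.1.1 _ hpq'.1.1).1 he.1
    have e2 := (h _ hpq.1.2 _ hpq'.1.2).1 he.2
    exact ⟨Prod.ext he.1 e1, Prod.ext he.2 e2⟩
  · rintro ⟨i, j⟩ hij
    rw [Finset.mem_filter, mem_Inv] at hij
    obtain ⟨⟨h1, u, v, hu, hv, h2⟩, h3⟩ := hij
    refine ⟨((i, u), (j, v)), ?_, rfl⟩
    simp only [Finset.mem_filter, Finset.mem_product]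
    exact ⟨⟨hu, hv⟩, h1, h2, (hPQ _ hu _ hv h1).2 h3⟩

theorem invCount_eq {n : ℕ} {f : Finset (Fin n × Fin n)} (h : GInj f) :
    invCount f = (Inv f).card := by
  have := card_cross h (fun _ _ => True) (fun _ => True) (by simp)
  simpa [invCount] using this

theorem delCoeff_eq {n : ℕ} (d c : StrandsDiagram n) :
    delCoeff d c = (((Inv d.g).filter fun x => act x.1 x.2 d.g = c.g ∧
      invCount (act x.1 x.2 d.g) + 1 = invCount d.g).card : ZMod 2) := by
  rw [delCoeff]
  congr 1
  apply card_cross (f := d.g) d.inj (fun p q => resGraph d.g p q = c.g ∧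
      invCount (resGraph d.g p q) + 1 = invCount d.g)
  intro p hp q hq hlt
  rw [resGraph_eq d.inj hp hq hlt.ne]

/-- Resolution of a crossing, as a diagram. -/
def res {n : ℕ} (d : StrandsDiagram n) (i j : Fin n) (h1 : i < j) (h2 : R d.g i j) :
    StrandsDiagram n where
  g := act i j d.g
  inj := GInj_act i j d.inj
  slope := by
    rintro ⟨x, w⟩ hx
    rw [mem_act] at hx
    obtain ⟨u, v, hu, hv, huv⟩ := h2
    have hs := d.slope _ hx
    have hsv := d.slope _ hv
    simp only at hs hsv ⊢
    by_cases h1 : x = i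
    · subst h1
      rw [swap_apply_left] at hs
      omega
    · by_cases h2 : x = j
      · subst h2
        rw [swap_apply_right] at hx
        have := GInj.right d.inj hx hu
        omega
      · rwa [swap_apply_of_ne_of_ne h1 h2] at hs

/-- Sum against the differential. -/
theorem sum_delCoeff {n : ℕ} (d : StrandsDiagram n) (F : Finset (Fin n × Fin n) → ZMod 2) :
    ∑ d' : StrandsDiagram n, delCoeff d d' * F d'.g =
      ∑ x ∈ (Inv d.g).filter (fun x => invCount (act x.1 x.2 d.g) + 1 = invCount d.g),
        F (act x.1 x.2 d.g) := by
  simp only [delCoeff_eq, Finset.card_eq_sum_ones, Nat.cast_sum, Finset.sum_mul]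
  simp only [Finset.sum_filter]
  rw [Finset.sum_comm]
  apply Finset.sum_congr rfl
  intro x hx
  rw [mem_Inv] at hx
  rw [Finset.sum_eq_single (res d x.1 x.2 hx.1 hx.2)]
  · simp [res]
  · intro b _ hb
    rw [if_neg]
    · rintro ⟨h, _⟩
      exact hb (ext' h.symm)
  · simp

theorem invCount_act_lt {n : ℕ} {f : Finset (Fin n × Fin n)} (h : GInj f) {i j : Fin n}
    (hij : i < j) (hR : R f i j) : invCount (act i j f) < invCount f := by
  rw [invCount_eq h, invCount_eq (GInj_act i j h)]
  have hmem : (i, j) ∈ Inv f := mem_Inv.2 ⟨hij, hR⟩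
  have : (Inv (act i j f)).card ≤ ((Inv f).erase (i, j)).card := by
    apply Finset.card_le_card_of_injOn
      (fun x => if swap i j x.1 < swap i j x.2 then (swap i j x.1, swap i j x.2) else x)
    · rintro ⟨x, y⟩ hx
      simp only [Finset.mem_coe, mem_Inv, R_act, Finset.mem_erase] at hx ⊢
      obtain ⟨h1, h2⟩ := hx
      have ha : ¬ R f j i := fun h' => R_asymm h hR h'
      have ht1 : ∀ z, R f j z → R f i z := fun z => R_trans h hR
      have ht2 : ∀ z, R f z i → R f z j := fun z h' => R_trans h h' hR
      split_ifs with hs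
      · refine ⟨?_, hs, h2⟩
        intro he
        simp only [Prod.mk.injEq] at he
        simp only [swap_apply_def] at he
        grind
      · simp only [swap_apply_def] at hs h2
        refine ⟨?_, h1, ?_⟩ <;> grind
    · rintro ⟨x, y⟩ hx ⟨x', y'⟩ hx' he
      simp only [Finset.mem_coe, mem_Inv, R_act] at hx hx'
      simp only at he
      split_ifs at he with h1 h2 h2
      · simpa using he
      · simp only [Prod.mk.injEq] at he
        obtain ⟨rfl, rfl⟩ := he
        simp at h2
        omega
      · simp only [Prod.mk.injEq] at he
        obtain ⟨rfl, rfl⟩ := he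
        simp at h1
        omega
      · exact he
  have := Finset.card_erase_lt_of_mem hmem
  omega

theorem mem_comp {n : ℕ} (f h : Finset (Fin n × Fin n)) (x z : Fin n) :
    (x, z) ∈ compGraph f h ↔ ∃ y, (x, y) ∈ f ∧ (y, z) ∈ h := by
  simp only [compGraph, Finset.mem_image, Finset.mem_filter, Finset.mem_product, Prod.exists,
    Prod.mk.injEq]
  constructor
  · rintro ⟨a, b, c, d, ⟨⟨h1, h2⟩, rfl⟩, rfl, rfl⟩
    exact ⟨_, h1, h2⟩
  · rintro ⟨y, h1, h2⟩
    exact ⟨_, _, _, _, ⟨⟨h1, h2⟩, rfl⟩, rfl, rfl⟩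

theorem GInj_comp {n : ℕ} {f h : Finset (Fin n × Fin n)} (hf : GInj f) (hh : GInj h) :
    GInj (compGraph f h) := by
  rintro ⟨x, z⟩ h1 ⟨x', z'⟩ h2
  rw [mem_comp] at h1 h2
  obtain ⟨y, a, b⟩ := h1
  obtain ⟨y', a', b'⟩ := h2
  have e1 := hf _ a _ a'
  have e2 := hh _ b _ b'
  simp only at e1 e2 ⊢
  rw [e1, e2]

/-- Composition of diagrams. -/
def comp {n : ℕ} (a b : StrandsDiagram n) : StrandsDiagram n where
  g := compGraph a.g b.g
  inj := GInj_comp a.inj b.inj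
  slope := by
    rintro ⟨x, z⟩ h
    rw [mem_comp] at h
    obtain ⟨y, h1, h2⟩ := h
    exact (a.slope _ h1).trans (b.slope _ h2)

theorem compGraph_assoc {n : ℕ} (f g h : Finset (Fin n × Fin n)) :
    compGraph (compGraph f g) h = compGraph f (compGraph g h) := by
  ext ⟨x, z⟩
  simp only [mem_comp]
  grind

/-- `f` followed by `h` inverts the pair of middle points. -/
def Q {n : ℕ} (f h : Finset (Fin n × Fin n)) (x : Fin n × Fin n) : Prop :=
  x.1 < x.2 ∧ ∃ u v, (x.1, u) ∈ f ∧ (x.2, v) ∈ f ∧ ((u < v ∧ R h u v) ∨ (v < u ∧ R h v u))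

/-- Correspondence of source pairs and middle pairs. -/
def Rel {n : ℕ} (f : Finset (Fin n × Fin n)) (x y : Fin n × Fin n) : Prop :=
  ((x.1, y.1) ∈ f ∧ (x.2, y.2) ∈ f) ∨ ((x.1, y.2) ∈ f ∧ (x.2, y.1) ∈ f)

theorem Rel_left {n : ℕ} {f : Finset (Fin n × Fin n)} (h : GInj f) {x x' y : Fin n × Fin n}
    (hx : x.1 < x.2) (hx' : x'.1 < x'.2) (h1 : Rel f x y) (h2 : Rel f x' y) : x = x' := by
  have := fun a b c => @GInj.left n f h a b c
  unfold Rel at h1 h2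
  grind

theorem Rel_right {n : ℕ} {f : Finset (Fin n × Fin n)} (h : GInj f) {x y y' : Fin n × Fin n}
    (hx : y.1 < y.2) (hx' : y'.1 < y'.2) (h1 : Rel f x y) (h2 : Rel f x y') : y = y' := by
  have := fun a b c => @GInj.right n f h a b c
  unfold Rel at h1 h2
  grind

theorem Q_exists {n : ℕ} {f h : Finset (Fin n × Fin n)} {x : Fin n × Fin n} (hx : Q f h x) :
    ∃ y ∈ Inv h, Rel f x y := by
  obtain ⟨_, u, v, h1, h2, h3 | h3⟩ := hx
  · exact ⟨(u, v), mem_Inv.2 h3, Or.inl ⟨h1, h2⟩⟩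
  · exact ⟨(v, u), mem_Inv.2 h3, Or.inr ⟨h1, h2⟩⟩

theorem comp_R {n : ℕ} {f h : Finset (Fin n × Fin n)} (hf : GInj f) (hh : GInj h)
    (hd : f.image Prod.snd = h.image Prod.fst) {x : Fin n × Fin n} :
    x ∈ Inv (compGraph f h) ↔ ((x ∈ Inv f ∧ ¬ Q f h x) ∨ (x ∉ Inv f ∧ Q f h x)) := by
  obtain ⟨x, y⟩ := x
  simp only [mem_Inv, Q]
  by_cases hxy : x < y
  swap
  · simp [hxy]
  simp only [hxy, true_and]
  by_cases hx : ∃ u, (x, u) ∈ f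
  swap
  · simp only [R, mem_comp]
    grind
  by_cases hy : ∃ u, (y, u) ∈ f
  swap
  · simp only [R, mem_comp]
    grind
  obtain ⟨u, hu⟩ := hx
  obtain ⟨v, hv⟩ := hy
  have hex : ∀ x u, (x, u) ∈ f → ∃ w, (u, w) ∈ h := by
    intro x u hu
    have : u ∈ f.image Prod.snd := Finset.mem_image.2 ⟨_, hu, rfl⟩
    rw [hd, Finset.mem_image] at this
    obtain ⟨⟨a, b⟩, h1, h2⟩ := this
    simp only at h2
    subst h2
    exact ⟨_, h1⟩
  obtain ⟨u', hu'⟩ := hex _ _ hu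
  obtain ⟨v', hv'⟩ := hex _ _ hv
  have fr := fun a b c => @GInj.right n f hf a b c
  have hr := fun a b c => @GInj.right n h hh a b c
  have e1 : R (compGraph f h) x y ↔ v' < u' := by
    simp only [R, mem_comp]
    grind
  have e2 : R f x y ↔ v < u := by
    simp only [R]
    grind
  have e3 : (∃ u v, (x, u) ∈ f ∧ (y, v) ∈ f ∧ ((u < v ∧ R h u v) ∨ (v < u ∧ R h v u))) ↔
      ((u < v ∧ v' < u') ∨ (v < u ∧ u' < v')) := by
    simp only [R]
    grind
  have e4 : u ≠ v := by
    rintro rfl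
    exact hxy.ne (hf.left hu hv)
  have e5 : u' ≠ v' := by
    rintro rfl
    exact e4 (hh.left hu' hv')
  rw [e1, e2, e3]
  grind

theorem invCount_comp_le {n : ℕ} {f h : Finset (Fin n × Fin n)} (hf : GInj f) (hh : GInj h)
    (hd : f.image Prod.snd = h.image Prod.fst) :
    invCount (compGraph f h) ≤ invCount f + invCount h := by
  classical
  rw [invCount_eq hf, invCount_eq hh, invCount_eq (GInj_comp hf hh)]
  have h1 : (Inv (compGraph f h) \ Inv f).card ≤ (Inv h).card := by
    apply Finset.card_le_card_of_forall_subsingleton (Rel f)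
    · intro x hx
      rw [Finset.mem_sdiff, comp_R hf hh hd] at hx
      have : Q f h x := by tauto
      exact Q_exists this
    · intro y hy x hx x' hx'
      simp only [Set.mem_ofPred_eq, Finset.mem_sdiff, mem_Inv] at hx hx'
      exact Rel_left hf hx.1.1.1 hx'.1.1.1 hx.2 hx'.2
  have := Finset.card_le_card_sdiff_add_card (s := Inv (compGraph f h)) (t := Inv f)
  omega


theorem act_act_congr {n : ℕ} {f : Finset (Fin n × Fin n)} {i j k l i' j' k' l' : Fin n}
    (h : ∀ x, swap i j (swap k l x) = swap i' j' (swap k' l' x)) :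
    act k l (act i j f) = act k' l' (act i' j' f) := by
  ext ⟨x, u⟩
  rw [mem_act, mem_act, mem_act, mem_act, h]

open Classical in
/-- The partner of a chain of two resolutions. -/
noncomputable def partner {n : ℕ} (f : Finset (Fin n × Fin n))
    (z : (Fin n × Fin n) × (Fin n × Fin n)) : (Fin n × Fin n) × (Fin n × Fin n) :=
  if z.1.1 = z.2.1 then
    if z.1.2 < z.2.2 then ((z.1.2, z.2.2), (z.1.1, z.1.2)) else ((z.1.1, z.2.2), (z.2.2, z.1.2))
  else if z.1.2 = z.2.2 then
    if z.2.1 < z.1.1 then ((z.2.1, z.1.1), (z.1.1, z.1.2)) else ((z.2.1, z.1.2), (z.1.1, z.2.1))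
  else if z.1.2 = z.2.1 then
    if R f z.1.2 z.2.2 then ((z.1.2, z.2.2), (z.1.1, z.2.2)) else ((z.1.1, z.2.2), (z.1.1, z.1.2))
  else if z.1.1 = z.2.2 then
    if R f z.2.1 z.1.1 then ((z.2.1, z.1.1), (z.2.1, z.1.2)) else ((z.2.1, z.1.2), (z.1.1, z.1.2))
  else (z.2, z.1)

/-- Chains of two resolutions. -/
def Chain {n : ℕ} (f : Finset (Fin n × Fin n)) (z : (Fin n × Fin n) × (Fin n × Fin n)) : Prop :=
  z.1.1 < z.1.2 ∧ R f z.1.1 z.1.2 ∧ z.2.1 < z.2.2 ∧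
    R f (swap z.1.1 z.1.2 z.2.1) (swap z.1.1 z.1.2 z.2.2)

theorem partner_spec {n : ℕ} {f : Finset (Fin n × Fin n)} (h : GInj f)
    (z : (Fin n × Fin n) × (Fin n × Fin n)) (hz : Chain f z) :
    Chain f (partner f z) ∧ partner f z ≠ z ∧ partner f (partner f z) = z ∧
      ∀ x, swap (partner f z).1.1 (partner f z).1.2
        (swap (partner f z).2.1 (partner f z).2.2 x) =
          swap z.1.1 z.1.2 (swap z.2.1 z.2.2 x) := by
  obtain ⟨⟨i, j⟩, ⟨k, l⟩⟩ := z
  obtain ⟨h1, h2, h3, h4⟩ := hz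
  simp only at h1 h2 h3 h4
  have hasymm : ∀ x y, R f x y → ¬ R f y x := fun x y h1 h2 => R_asymm h h1 h2
  have htrans : ∀ x y z, R f x y → R f y z → R f x z := fun x y z => R_trans h
  have htot : ∀ x y z w, (R f x y ∨ R f y x) → (R f z w ∨ R f w z) → x ≠ z →
    R f x z ∨ R f z x := fun x y z w => R_total h
  by_cases e1 : i = k
  · subst e1
    by_cases e2 : j < l
    · have hp : partner f ((i, j), (i, l)) = ((j, l), (i, j)) := by simp [partner, e2]
      have h5 : R f j l := by
        simp only [swap_apply_def] at h4
        grind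
      rw [hp]
      refine ⟨?_, ?_, ?_, ?_⟩
      · simp only [Chain, swap_apply_def]; grind
      · grind
      · simp only [partner]; grind
      · simp only [swap_apply_def]; grind
    · by_cases e3 : j = l
      · subst e3
        simp only [swap_apply_left, swap_apply_right] at h4
        exact absurd h4 (hasymm _ _ h2)
      · have hp : partner f ((i, j), (i, l)) = ((i, l), (l, j)) := by simp [partner, e2]
        have h5 : R f j l := by
          simp only [swap_apply_def] at h4
          grind
        rw [hp]
        refine ⟨?_, ?_, ?_, ?_⟩
        · simp only [Chain, swap_apply_def]; grind
        · grind
        · simp only [partner]; grind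
        · simp only [swap_apply_def]; grind
  by_cases e2 : j = l
  · subst e2
    have h5 : R f k i := by
      simp only [swap_apply_def] at h4
      grind
    by_cases e3 : k < i
    · have hp : partner f ((i, j), (k, j)) = ((k, i), (i, j)) := by simp [partner, e1, e3]
      rw [hp]
      refine ⟨?_, ?_, ?_, ?_⟩
      · simp only [Chain, swap_apply_def]; grind
      · grind
      · simp only [partner]; grind
      · simp only [swap_apply_def]; grind
    · have hp : partner f ((i, j), (k, j)) = ((k, j), (i, k)) := by simp [partner, e1, e3]
      rw [hp]
      refine ⟨?_, ?_, ?_, ?_⟩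
      · simp only [Chain, swap_apply_def]; grind
      · grind
      · simp only [partner]; grind
      · simp only [swap_apply_def]; grind
  by_cases e3 : j = k
  · subst e3
    have h5 : R f i l := by
      simp only [swap_apply_def] at h4
      grind
    have h6 := htot j i l i (Or.inr h2) (Or.inr h5) e2
    by_cases e4 : R f j l
    · have hp : partner f ((i, j), (j, l)) = ((j, l), (i, l)) := by simp [partner, e1, e2, e4]
      rw [hp]
      refine ⟨?_, ?_, ?_, ?_⟩
      · simp only [Chain, swap_apply_def]; grind
      · grind
      · simp only [partner]; grind
      · simp only [swap_apply_def]; grind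
    · have hp : partner f ((i, j), (j, l)) = ((i, l), (i, j)) := by simp [partner, e1, e2, e4]
      rw [hp]
      refine ⟨?_, ?_, ?_, ?_⟩
      · simp only [Chain, swap_apply_def]; grind
      · grind
      · simp only [partner]; grind
      · simp only [swap_apply_def]; grind
  by_cases e4 : i = l
  · subst e4
    have h5 : R f k j := by
      simp only [swap_apply_def] at h4
      grind
    have h6 := htot k j i j (Or.inl h5) (Or.inl h2) (Ne.symm e1)
    by_cases e5 : R f k i
    · have hp : partner f ((i, j), (k, i)) = ((k, i), (k, j)) := by
        simp [partner, e1, e2, e3, e5]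
      rw [hp]
      refine ⟨?_, ?_, ?_, ?_⟩
      · simp only [Chain, swap_apply_def]; grind
      · grind
      · simp only [partner]; grind
      · simp only [swap_apply_def]; grind
    · have hp : partner f ((i, j), (k, i)) = ((k, j), (i, j)) := by
        simp [partner, e1, e2, e3, e5]
      rw [hp]
      refine ⟨?_, ?_, ?_, ?_⟩
      · simp only [Chain, swap_apply_def]; grind
      · grind
      · simp only [partner]; grind
      · simp only [swap_apply_def]; grind
  have hp : partner f ((i, j), (k, l)) = ((k, l), (i, j)) := by
    simp [partner, e1, e2, e3, e4]
  rw [hp]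
  refine ⟨?_, ?_, ?_, ?_⟩
  · simp only [Chain, swap_apply_def] at h4 ⊢; grind
  · grind
  · simp only [partner]; grind
  · simp only [swap_apply_def]; grind

open Classical in
theorem chain_even {n : ℕ} {f : Finset (Fin n × Fin n)} (h : GInj f)
    (c : Finset (Fin n × Fin n)) :
    ∑ z : (Fin n × Fin n) × (Fin n × Fin n),
      (if Chain f z ∧ act z.2.1 z.2.2 (act z.1.1 z.1.2 f) = c then (1 : ZMod 2) else 0) = 0 := by
  rw [← Finset.sum_filter]
  apply Finset.sum_involution (fun z _ => partner f z)
  · intro z _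
    decide
  · intro z hz _
    simp only [Finset.mem_filter] at hz
    exact (partner_spec h z hz.2.1).2.1
  · intro z hz
    simp only [Finset.mem_filter, Finset.mem_univ, true_and] at hz ⊢
    obtain ⟨h1, h2, h3, h4⟩ := partner_spec h z hz.1
    refine ⟨h1, ?_⟩
    rw [← hz.2]
    exact act_act_congr h4
  · intro z hz
    simp only [Finset.mem_filter] at hz
    exact (partner_spec h z hz.2.1).2.2.1

theorem del_del {n : ℕ} (d c : StrandsDiagram n) :
    ∑ e : StrandsDiagram n, delCoeff d e * delCoeff e c = 0 := by
  classical
  have h0 := sum_delCoeff d (fun g => (((Inv g).filter fun x => act x.1 x.2 g = c.g ∧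
      invCount (act x.1 x.2 g) + 1 = invCount g).card : ZMod 2))
  simp only [delCoeff_eq _ c]
  rw [h0]
  by_cases hc : invCount c.g + 2 = invCount d.g
  swap
  · apply Finset.sum_eq_zero
    intro x hx
    simp only [Finset.mem_filter] at hx
    rw [Finset.filter_false_of_mem]
    · simp
    · rintro y hy ⟨h1, h2⟩
      rw [h1] at h2
      omega
  rw [← chain_even d.inj c.g, Fintype.sum_prod_type, Finset.sum_filter, Inv, Finset.sum_filter]
  apply Finset.sum_congr rfl
  intro x _
  rw [Finset.card_eq_sum_ones, Nat.cast_sum, Finset.sum_filter, Inv, Finset.sum_filter]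
  by_cases hx : x.1 < x.2 ∧ R d.g x.1 x.2
  swap
  · rw [if_neg hx]
    symm
    apply Finset.sum_eq_zero
    intro y _
    rw [if_neg]
    rintro ⟨⟨h1, h2, -⟩, -⟩
    exact hx ⟨h1, h2⟩
  rw [if_pos hx]
  have hlt := invCount_act_lt d.inj hx.1 hx.2
  have key : ∀ y : Fin n × Fin n,
      (Chain d.g (x, y) ∧ act y.1 y.2 (act x.1 x.2 d.g) = c.g) →
      invCount (act x.1 x.2 d.g) + 1 = invCount d.g ∧
      invCount c.g + 1 = invCount (act x.1 x.2 d.g) := by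
    rintro y ⟨⟨h1, h2, h3, h4⟩, h5⟩
    have := invCount_act_lt (GInj_act x.1 x.2 d.inj) h3 ((R_act _ _ _ _ _).2 h4)
    simp only at this
    rw [h5] at this
    omega
  split_ifs with h1
  · apply Finset.sum_congr rfl
    intro y _
    rw [R_act]
    have := key y
    have e : Chain d.g (x, y) ↔ (y.1 < y.2 ∧ R d.g (swap x.1 x.2 y.1) (swap x.1 x.2 y.2)) := by
      simp only [Chain]
      tauto
    rw [e] at this ⊢
    by_cases h2 : (y.1 < y.2 ∧ R d.g (swap x.1 x.2 y.1) (swap x.1 x.2 y.2))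
    · by_cases h3 : act y.1 y.2 (act x.1 x.2 d.g) = c.g
      · simp [h2, h3, this ⟨h2, h3⟩]
      · simp [h3]
    · simp [h2]
  · symm
    apply Finset.sum_eq_zero
    intro y _
    rw [if_neg]
    intro hh
    exact h1 (key y hh).1

theorem act_comp {n : ℕ} (i j : Fin n) (f h : Finset (Fin n × Fin n)) :
    act i j (compGraph f h) = compGraph (act i j f) h := by
  ext ⟨x, z⟩
  simp only [mem_act, mem_comp]

theorem act_comp_right {n : ℕ} {f : Finset (Fin n × Fin n)} (hf : GInj f)
    (h : Finset (Fin n × Fin n)) {x y : Fin n × Fin n} (hr : Rel f x y) :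
    act x.1 x.2 (compGraph f h) = compGraph f (act y.1 y.2 h) := by
  have key : ∀ a b, (swap x.1 x.2 a, b) ∈ f ↔ (a, swap y.1 y.2 b) ∈ f := by
    intro a b
    have fr := fun a b c => @GInj.right n f hf a b c
    have fl := fun a b c => @GInj.left n f hf a b c
    simp only [swap_apply_def]
    unfold Rel at hr
    grind
  ext ⟨a, z⟩
  simp only [mem_act, mem_comp, key]
  constructor
  · rintro ⟨b, h1, h2⟩
    exact ⟨swap y.1 y.2 b, h1, by simpa using h2⟩
  · rintro ⟨b, h1, h2⟩
    exact ⟨swap y.1 y.2 b, by simpa using h1, h2⟩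

/-- The unrestricted Leibniz rule. -/
theorem leibniz_full {n : ℕ} {f h : Finset (Fin n × Fin n)} (hf : GInj f) (hh : GInj h)
    (hd : f.image Prod.snd = h.image Prod.fst) (c : Finset (Fin n × Fin n)) :
    (((Inv (compGraph f h)).filter fun x => act x.1 x.2 (compGraph f h) = c).card : ZMod 2) =
      (((Inv f).filter fun x => compGraph (act x.1 x.2 f) h = c).card : ZMod 2) +
      (((Inv h).filter fun x => compGraph f (act x.1 x.2 h) = c).card : ZMod 2) := by
  classical
  set P : Fin n × Fin n → Prop := fun x => act x.1 x.2 (compGraph f h) = c with hP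
  have hB : ((Inv h).filter fun x => compGraph f (act x.1 x.2 h) = c).card =
      (Finset.univ.filter fun x => Q f h x ∧ P x).card := by
    apply le_antisymm
    · apply Finset.card_le_card_of_forall_subsingleton (fun y x => Rel f x y)
      · rintro ⟨u, v⟩ hy
        rw [Finset.mem_filter] at hy
        obtain ⟨hy, hc⟩ := hy
        have hy' := mem_Inv.1 hy
        obtain ⟨huv, u', v', hu, hv, hlt⟩ := hy'
        have hex : ∀ u w, (u, w) ∈ h → ∃ x, (x, u) ∈ f := by
          intro u w hw
          have : u ∈ h.image Prod.fst := Finset.mem_image.2 ⟨_, hw, rfl⟩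
          rw [← hd, Finset.mem_image] at this
          obtain ⟨⟨a, b⟩, h1, h2⟩ := this
          simp only at h2
          subst h2
          exact ⟨_, h1⟩
        obtain ⟨x, hx⟩ := hex _ _ hu
        obtain ⟨y, hy2⟩ := hex _ _ hv
        rcases lt_trichotomy x y with hxy | hxy | hxy
        · have hr : Rel f (x, y) (u, v) := Or.inl ⟨hx, hy2⟩
          refine ⟨(x, y), ?_, hr⟩
          rw [Finset.mem_filter]
          exact ⟨Finset.mem_univ _, ⟨hxy, u, v, hx, hy2, Or.inl (mem_Inv.1 hy)⟩,
            (act_comp_right hf h hr).trans hc⟩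
        · subst hxy
          exact absurd (hf.right hx hy2) huv.ne
        · have hr : Rel f (y, x) (u, v) := Or.inr ⟨hy2, hx⟩
          refine ⟨(y, x), ?_, hr⟩
          rw [Finset.mem_filter]
          exact ⟨Finset.mem_univ _, ⟨hxy, v, u, hy2, hx, Or.inr (mem_Inv.1 hy)⟩,
            (act_comp_right hf h hr).trans hc⟩
      · intro x hx y hy y' hy'
        simp only [Set.mem_ofPred_eq, Finset.mem_filter, mem_Inv] at hy hy'
        exact Rel_right hf hy.1.1.1 hy'.1.1.1 hy.2 hy'.2
    · apply Finset.card_le_card_of_forall_subsingleton (Rel f)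
      · intro x hx
        rw [Finset.mem_filter] at hx
        obtain ⟨y, hy, hr⟩ := Q_exists hx.2.1
        refine ⟨y, Finset.mem_filter.2 ⟨hy, ?_⟩, hr⟩
        exact (act_comp_right hf h hr).symm.trans hx.2.2
      · intro y hy x hx x' hx'
        simp only [Set.mem_ofPred_eq, Finset.mem_filter] at hx hx'
        exact Rel_left hf hx.1.2.1.1 hx'.1.2.1.1 hx.2 hx'.2
  rw [hB]
  simp only [← act_comp]
  rw [← Finset.filter_univ_mem (Inv (compGraph f h)), ← Finset.filter_univ_mem (Inv f)]
  simp only [Finset.filter_filter, Finset.card_eq_sum_ones, Nat.cast_sum, Finset.sum_filter]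
  rw [← Finset.sum_add_distrib]
  apply Finset.sum_congr rfl
  intro x _
  have hc := comp_R hf hh hd (x := x)
  simp only [hP]
  have h2' : (0 : ZMod 2) = 1 + 1 := by decide
  by_cases h1 : act x.1 x.2 (compGraph f h) = c <;> by_cases h2 : x ∈ Inv f <;>
    by_cases h3 : Q f h x <;> simp [h1, h2, h3, hc, h2']

theorem sdel_sdel {n : ℕ} (x : StrandsAlg n) : sdel (sdel x) = 0 := by
  funext c
  simp only [sdel, Finset.mul_sum, Pi.zero_apply]
  rw [Finset.sum_comm]
  apply Finset.sum_eq_zero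
  intro d _
  have := del_del d c
  calc ∑ e : StrandsDiagram n, delCoeff e c * (delCoeff d e * x d)
      = (∑ e : StrandsDiagram n, delCoeff d e * delCoeff e c) * x d := by
        rw [Finset.sum_mul]
        apply Finset.sum_congr rfl
        intro e _
        ring
    _ = 0 := by rw [this, zero_mul]

theorem sdel_add {n : ℕ} (x y : StrandsAlg n) : sdel (x + y) = sdel x + sdel y := by
  funext c
  simp only [sdel, Pi.add_apply, mul_add, Finset.sum_add_distrib]

/-- Structure constants of the multiplication, on graphs. -/
def M {n : ℕ} (a b c : Finset (Fin n × Fin n)) : ZMod 2 :=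
  if a.image Prod.snd = b.image Prod.fst ∧ c = compGraph a b ∧
    invCount c = invCount a + invCount b then 1 else 0

theorem smul'_eq {n : ℕ} (x y : StrandsAlg n) (c : StrandsDiagram n) :
    smul' x y c = ∑ a : StrandsDiagram n, ∑ b : StrandsDiagram n, M a.g b.g c.g * (x a * y b) := by
  simp only [smul', M, cod, dom, ite_mul, one_mul, zero_mul]
  congr!

theorem sum_M {n : ℕ} (a b : StrandsDiagram n) (F : Finset (Fin n × Fin n) → ZMod 2) :
    ∑ e : StrandsDiagram n, M a.g b.g e.g * F e.g =
      M a.g b.g (compGraph a.g b.g) * F (compGraph a.g b.g) := by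
  rw [Finset.sum_eq_single (comp a b)]
  · rfl
  · intro e _ he
    rw [M, if_neg, zero_mul]
    rintro ⟨-, h, -⟩
    exact he (ext' h)
  · simp

theorem image_snd_comp {n : ℕ} {f h : Finset (Fin n × Fin n)}
    (hd : f.image Prod.snd = h.image Prod.fst) :
    (compGraph f h).image Prod.snd = h.image Prod.snd := by
  have hd' : ∀ u, (∃ x, (x, u) ∈ f) ↔ ∃ w, (u, w) ∈ h := by
    intro u
    have := congrArg (fun s => u ∈ s) hd
    simpa using this
  ext w
  simp only [Finset.mem_image, Prod.exists, mem_comp, exists_eq_right]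
  constructor
  · rintro ⟨x, y, h1, h2⟩
    exact ⟨y, h2⟩
  · rintro ⟨y, h2⟩
    obtain ⟨x, h1⟩ := (hd' y).2 ⟨w, h2⟩
    exact ⟨x, y, h1, h2⟩

theorem image_fst_comp {n : ℕ} {f h : Finset (Fin n × Fin n)}
    (hd : f.image Prod.snd = h.image Prod.fst) :
    (compGraph f h).image Prod.fst = f.image Prod.fst := by
  have hd' : ∀ u, (∃ x, (x, u) ∈ f) ↔ ∃ w, (u, w) ∈ h := by
    intro u
    have := congrArg (fun s => u ∈ s) hd
    simpa using this
  ext w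
  simp only [Finset.mem_image, Prod.exists, mem_comp, exists_and_right, exists_eq_right]
  constructor
  · rintro ⟨x, y, h1, h2⟩
    exact ⟨y, h1⟩
  · rintro ⟨y, h1⟩
    obtain ⟨x, h2⟩ := (hd' y).1 ⟨w, h1⟩
    exact ⟨x, y, h1, h2⟩

theorem M_assoc {n : ℕ} {a b c d : Finset (Fin n × Fin n)} (ha : GInj a) (hb : GInj b)
    (hc : GInj c) :
    M a b (compGraph a b) * M (compGraph a b) c d =
      M b c (compGraph b c) * M a (compGraph b c) d := by
  by_cases h1 : a.image Prod.snd = b.image Prod.fst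
  · by_cases h2 : b.image Prod.snd = c.image Prod.fst
    · have e1 := image_snd_comp h1
      have e2 := image_fst_comp h2
      have l1 := invCount_comp_le ha hb h1
      have l2 := invCount_comp_le hb hc h2
      have l3 := invCount_comp_le (GInj_comp ha hb) hc (e1.trans h2)
      have l4 := invCount_comp_le ha (GInj_comp hb hc) (h1.trans e2.symm)
      simp only [M, e1, e2, h1, h2, true_and, compGraph_assoc] at l3 ⊢
      by_cases h3 : d = compGraph a (compGraph b c)
      · subst h3
        simp only [true_and, mul_ite, mul_one, mul_zero]
        split_ifs <;> first | rfl | omega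
      · simp [h3]
    · have : M b c (compGraph b c) = 0 := by simp [M, h2]
      rw [this, zero_mul]
      have : M (compGraph a b) c d = 0 := by simp [M, image_snd_comp h1, h2]
      rw [this, mul_zero]
  · have : M a b (compGraph a b) = 0 := by simp [M, h1]
    rw [this, zero_mul]
    by_cases h2 : b.image Prod.snd = c.image Prod.fst
    · have : M a (compGraph b c) d = 0 := by simp [M, image_fst_comp h2, h1]
      rw [this, mul_zero]
    · have : M b c (compGraph b c) = 0 := by simp [M, h2]
      rw [this, zero_mul]

theorem smul'_assoc {n : ℕ} (x y z : StrandsAlg n) :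
    smul' (smul' x y) z = smul' x (smul' y z) := by
  funext d
  have hL : smul' (smul' x y) z d = ∑ a : StrandsDiagram n, ∑ b : StrandsDiagram n,
      ∑ c : StrandsDiagram n, (∑ e : StrandsDiagram n, M a.g b.g e.g * M e.g c.g d.g) *
        (x a * y b * z c) := by
    simp only [smul'_eq, Finset.sum_mul, Finset.mul_sum]
    calc _ = ∑ e : StrandsDiagram n, ∑ a : StrandsDiagram n, ∑ b : StrandsDiagram n,
          ∑ c : StrandsDiagram n, M a.g b.g e.g * M e.g c.g d.g * (x a * y b * z c) := by
          apply Finset.sum_congr rfl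
          intro e _
          rw [Finset.sum_comm]
          apply Finset.sum_congr rfl
          intro a _
          rw [Finset.sum_comm]
          apply Finset.sum_congr rfl
          intro b _
          apply Finset.sum_congr rfl
          intro c _
          ring
      _ = _ := by
          rw [Finset.sum_comm]
          apply Finset.sum_congr rfl
          intro a _
          rw [Finset.sum_comm]
          apply Finset.sum_congr rfl
          intro b _
          rw [Finset.sum_comm]
  have hR : smul' x (smul' y z) d = ∑ a : StrandsDiagram n, ∑ b : StrandsDiagram n,
      ∑ c : StrandsDiagram n, (∑ e : StrandsDiagram n, M b.g c.g e.g * M a.g e.g d.g) *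
        (x a * y b * z c) := by
    simp only [smul'_eq, Finset.sum_mul, Finset.mul_sum]
    apply Finset.sum_congr rfl
    intro a _
    rw [Finset.sum_comm]
    apply Finset.sum_congr rfl
    intro b _
    rw [Finset.sum_comm]
    apply Finset.sum_congr rfl
    intro c _
    apply Finset.sum_congr rfl
    intro e _
    ring
  rw [hL, hR]
  apply Finset.sum_congr rfl
  intro a _
  apply Finset.sum_congr rfl
  intro b _
  apply Finset.sum_congr rfl
  intro c _
  rw [sum_M a b (fun e => M e c.g d.g), sum_M b c (fun e => M a.g e d.g),
    M_assoc a.inj b.inj c.inj]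

theorem image_snd_act {n : ℕ} (i j : Fin n) (f : Finset (Fin n × Fin n)) :
    (act i j f).image Prod.snd = f.image Prod.snd := by
  simp only [act, Finset.image_image]
  rfl

theorem image_fst_act {n : ℕ} {i j : Fin n} {f : Finset (Fin n × Fin n)} (h : R f i j) :
    (act i j f).image Prod.fst = f.image Prod.fst := by
  obtain ⟨u, v, hu, hv, -⟩ := h
  ext x
  simp only [Finset.mem_image, Prod.exists, mem_act, exists_and_right, exists_eq_right,
    swap_apply_def]
  grind

theorem leibniz_coeff {n : ℕ} (a b c : StrandsDiagram n) :
    ∑ d : StrandsDiagram n, M a.g b.g d.g * delCoeff d c =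
      (∑ e : StrandsDiagram n, delCoeff a e * M e.g b.g c.g) +
      ∑ e : StrandsDiagram n, delCoeff b e * M a.g e.g c.g := by
  classical
  have h0 := sum_M a b (fun g => (((Inv g).filter fun x => act x.1 x.2 g = c.g ∧
      invCount (act x.1 x.2 g) + 1 = invCount g).card : ZMod 2))
  rw [sum_delCoeff a (fun e => M e b.g c.g), sum_delCoeff b (fun e => M a.g e c.g)]
  simp only [delCoeff_eq _ c]
  rw [h0]
  by_cases hd : a.g.image Prod.snd = b.g.image Prod.fst
  swap
  · have e1 : M a.g b.g (compGraph a.g b.g) = 0 := by simp [M, hd]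
    rw [e1, zero_mul, Finset.sum_eq_zero, Finset.sum_eq_zero, add_zero]
    · intro x hx
      rw [Finset.mem_filter, mem_Inv] at hx
      simp [M, image_fst_act hx.1.2, hd]
    · intro x hx
      simp [M, image_snd_act, hd]
  by_cases hc : invCount c.g + 1 = invCount a.g + invCount b.g
  swap
  · rw [Finset.sum_eq_zero, Finset.sum_eq_zero, add_zero]
    · by_cases h1 : invCount (compGraph a.g b.g) = invCount a.g + invCount b.g
      · rw [Finset.filter_false_of_mem]
        · simp
        · rintro x _ ⟨h2, h3⟩
          rw [h2] at h3
          omega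
      · simp [M, h1]
    · intro x hx
      rw [Finset.mem_filter] at hx
      rw [M, if_neg]
      rintro ⟨-, -, h⟩
      omega
    · intro x hx
      rw [Finset.mem_filter] at hx
      rw [M, if_neg]
      rintro ⟨-, -, h⟩
      omega
  have key := leibniz_full a.inj b.inj hd c.g
  have hle := invCount_comp_le a.inj b.inj hd
  have E1 : M a.g b.g (compGraph a.g b.g) *
      (((Inv (compGraph a.g b.g)).filter fun x => act x.1 x.2 (compGraph a.g b.g) = c.g ∧
      invCount (act x.1 x.2 (compGraph a.g b.g)) + 1 = invCount (compGraph a.g b.g)).card : ZMod 2)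
      = (((Inv (compGraph a.g b.g)).filter fun x =>
        act x.1 x.2 (compGraph a.g b.g) = c.g).card : ZMod 2) := by
    by_cases h1 : invCount (compGraph a.g b.g) = invCount a.g + invCount b.g
    · have : M a.g b.g (compGraph a.g b.g) = 1 := by simp [M, hd, h1]
      rw [this, one_mul]
      congr 2
      apply Finset.filter_congr
      intro x _
      constructor
      · exact fun h => h.1
      · intro h
        refine ⟨h, ?_⟩
        rw [h]
        omega
    · have : M a.g b.g (compGraph a.g b.g) = 0 := by simp [M, h1]
      rw [this, zero_mul, Finset.filter_false_of_mem]
      · simp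
      · intro x hx h
        rw [mem_Inv] at hx
        have := invCount_act_lt (GInj_comp a.inj b.inj) hx.1 hx.2
        rw [h] at this
        omega
  have E2 : ∑ x ∈ (Inv a.g).filter (fun x => invCount (act x.1 x.2 a.g) + 1 = invCount a.g),
      M (act x.1 x.2 a.g) b.g c.g =
      (((Inv a.g).filter fun x => compGraph (act x.1 x.2 a.g) b.g = c.g).card : ZMod 2) := by
    simp only [Finset.card_eq_sum_ones, Nat.cast_sum, Finset.sum_filter]
    apply Finset.sum_congr rfl
    intro x hx
    rw [mem_Inv] at hx
    have hd' := (image_snd_act x.1 x.2 a.g).trans hd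
    have h1 := invCount_comp_le (GInj_act x.1 x.2 a.inj) b.inj hd'
    have h2 := invCount_act_lt a.inj hx.1 hx.2
    by_cases h3 : compGraph (act x.1 x.2 a.g) b.g = c.g
    · rw [h3] at h1
      have h4 : invCount (act x.1 x.2 a.g) + 1 = invCount a.g := by omega
      have h5 : invCount c.g = invCount (act x.1 x.2 a.g) + invCount b.g := by omega
      rw [if_pos h4, if_pos h3, M, if_pos ⟨hd', h3.symm, h5⟩]
      simp
    · have h4 : M (act x.1 x.2 a.g) b.g c.g = 0 := if_neg (fun h => h3 h.2.1.symm)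
      simp [h3, h4]
  have E3 : ∑ x ∈ (Inv b.g).filter (fun x => invCount (act x.1 x.2 b.g) + 1 = invCount b.g),
      M a.g (act x.1 x.2 b.g) c.g =
      (((Inv b.g).filter fun x => compGraph a.g (act x.1 x.2 b.g) = c.g).card : ZMod 2) := by
    simp only [Finset.card_eq_sum_ones, Nat.cast_sum, Finset.sum_filter]
    apply Finset.sum_congr rfl
    intro x hx
    rw [mem_Inv] at hx
    have hd' := hd.trans (image_fst_act hx.2).symm
    have h1 := invCount_comp_le a.inj (GInj_act x.1 x.2 b.inj) hd'
    have h2 := invCount_act_lt b.inj hx.1 hx.2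
    by_cases h3 : compGraph a.g (act x.1 x.2 b.g) = c.g
    · rw [h3] at h1
      have h4 : invCount (act x.1 x.2 b.g) + 1 = invCount b.g := by omega
      have h5 : invCount c.g = invCount a.g + invCount (act x.1 x.2 b.g) := by omega
      rw [if_pos h4, if_pos h3, M, if_pos ⟨hd', h3.symm, h5⟩]
      simp
    · have h4 : M a.g (act x.1 x.2 b.g) c.g = 0 := if_neg (fun h => h3 h.2.1.symm)
      simp [h3, h4]
  rw [E1, E2, E3, key]

theorem leibniz {n : ℕ} (x y : StrandsAlg n) :
    sdel (smul' x y) = smul' (sdel x) y + smul' x (sdel y) := by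
  funext c
  have hL : sdel (smul' x y) c = ∑ a : StrandsDiagram n, ∑ b : StrandsDiagram n,
      (∑ d : StrandsDiagram n, M a.g b.g d.g * delCoeff d c) * (x a * y b) := by
    simp only [sdel, smul'_eq, Finset.mul_sum, Finset.sum_mul]
    rw [Finset.sum_comm]
    apply Finset.sum_congr rfl
    intro a _
    rw [Finset.sum_comm]
    apply Finset.sum_congr rfl
    intro b _
    apply Finset.sum_congr rfl
    intro d _
    ring
  have h1 : smul' (sdel x) y c = ∑ a : StrandsDiagram n, ∑ b : StrandsDiagram n,
      (∑ e : StrandsDiagram n, delCoeff a e * M e.g b.g c.g) * (x a * y b) := by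
    simp only [sdel, smul'_eq, Finset.mul_sum, Finset.sum_mul]
    calc _ = ∑ e : StrandsDiagram n, ∑ a : StrandsDiagram n, ∑ b : StrandsDiagram n,
          delCoeff a e * M e.g b.g c.g * (x a * y b) := by
          apply Finset.sum_congr rfl
          intro e _
          rw [Finset.sum_comm]
          apply Finset.sum_congr rfl
          intro a _
          apply Finset.sum_congr rfl
          intro b _
          ring
      _ = _ := by
          rw [Finset.sum_comm]
          apply Finset.sum_congr rfl
          intro a _
          rw [Finset.sum_comm]
  have h2 : smul' x (sdel y) c = ∑ a : StrandsDiagram n, ∑ b : StrandsDiagram n,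
      (∑ e : StrandsDiagram n, delCoeff b e * M a.g e.g c.g) * (x a * y b) := by
    simp only [sdel, smul'_eq, Finset.mul_sum, Finset.sum_mul]
    apply Finset.sum_congr rfl
    intro a _
    rw [Finset.sum_comm]
    apply Finset.sum_congr rfl
    intro b _
    apply Finset.sum_congr rfl
    intro e _
    ring
  rw [Pi.add_apply, hL, h1, h2, ← Finset.sum_add_distrib]
  apply Finset.sum_congr rfl
  intro a _
  rw [← Finset.sum_add_distrib]
  apply Finset.sum_congr rfl
  intro b _
  rw [leibniz_coeff, add_mul]

end StrandsDiagram

open StrandsDiagram in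
/-- The differential on the strands algebra `A(n)` squares to
zero and is additive; together with associativity and the Leibniz rule this makes
`(A(n), ∂)` a differential algebra over `𝔽₂`. -/
theorem strandsAlg_differential_squares_to_zero (n : ℕ) :
    (∀ x : StrandsAlg n, sdel (sdel x) = 0) ∧
    (∀ x y : StrandsAlg n, sdel (x + y) = sdel x + sdel y) ∧
    (∀ x y z : StrandsAlg n, smul' (smul' x y) z = smul' x (smul' y z)) ∧
    (∀ a b : StrandsAlg n,
      sdel (smul' a b) = smul' (sdel a) b + smul' a (sdel b)) := by
  exact ⟨fun x => sdel_sdel x, fun x y => sdel_add x y, fun x y z => smul'_assoc x y z,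
    fun a b => leibniz a b⟩
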